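/- If γ : ℝ → ℂ is a continuous path with ‖γ(t)‖ → ∞ as t → ∞ and exp(γ(t)) → w for some w ∈ ℂ as t → ∞, then w = 0. (The complex exponential has 0 as its unique finite asymptotic value.) -/

import Mathlib

/-- The complex exponential has `0` as its unique finite asymptotic value:
if `γ` is a continuous path with `‖γ t‖ → ∞` and `exp (γ t) → w`, then `w = 0`. -/
theorem stmt4 (γ : ℝ → ℂ) (hc : Continuous γ)
    (hinf : Filter.Tendsto (fun t => ‖γ t‖) Filter.atTop Filter.atTop)
    (w : ℂ)
    (hw : Filter.Tendsto (fun t => Complex.exp (γ t)) Filter.atTop (nhds w)) :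
    w = 0 := by
  by_contra hw0
  have hquot : Filter.Tendsto (fun t => Complex.exp (γ t) / w) Filter.atTop (nhds 1) := by
    simpa [hw0] using hw.div_const w
  have hlog : Filter.Tendsto (fun t => Complex.log (Complex.exp (γ t) / w))
      Filter.atTop (nhds 0) := by
    simpa using hquot.clog Complex.one_mem_slitPlane
  obtain ⟨T, hT⟩ := Filter.eventually_atTop.1
    (hquot.eventually (Complex.isOpen_slitPlane.mem_nhds Complex.one_mem_slitPlane))
  have hpi : (2 * Real.pi * Complex.I : ℂ) ≠ 0 := Complex.two_pi_I_ne_zero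
  let h : ℝ → ℂ := fun t =>
    (γ t - Complex.log (Complex.exp (γ t) / w) - Complex.log w) / (2 * Real.pi * Complex.I)
  have hcont : ContinuousOn h (Set.Ici T) := by
    have hg : ContinuousOn (fun t => Complex.log (Complex.exp (γ t) / w)) (Set.Ici T) :=
      ((Complex.continuous_exp.comp hc).div_const w).continuousOn.clog fun t ht => hT t ht
    exact ((hc.continuousOn.sub hg).sub continuousOn_const).div_const _
  have hmaps : Set.MapsTo h (Set.Ici T) (Set.range ((↑) : ℤ → ℂ)) := by
    intro t _
    have hexp : Complex.exp (γ t - Complex.log (Complex.exp (γ t) / w) - Complex.log w) = 1 := by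
      rw [Complex.exp_sub, Complex.exp_sub, Complex.exp_log hw0,
        Complex.exp_log (div_ne_zero (Complex.exp_ne_zero _) hw0)]
      field_simp [Complex.exp_ne_zero (γ t)]
    obtain ⟨n, hn⟩ := Complex.exp_eq_one_iff.1 hexp
    exact ⟨n, by simp only [h]; rw [hn, mul_div_cancel_right₀ _ hpi]⟩
  have hdisc : DiscreteTopology (Set.range ((↑) : ℤ → ℂ)) :=
    Complex.isClosedEmbedding_intCast.isEmbedding.toHomeomorph.symm.isEmbedding.discreteTopology
  have hconst : ∀ t ∈ Set.Ici T, h t = h T := fun t ht =>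
    isPreconnected_Ici.constant_of_mapsTo ⟨hdisc⟩ hcont hmaps ht Set.self_mem_Ici
  have hγ : Filter.Tendsto γ Filter.atTop
      (nhds (h T * (2 * Real.pi * Complex.I) + Complex.log w + 0)) := by
    refine (hlog.const_add (h T * (2 * Real.pi * Complex.I) + Complex.log w)).congr' ?_
    filter_upwards [Filter.eventually_ge_atTop T] with t ht
    rw [← hconst t ht]
    simp only [h]
    rw [div_mul_cancel₀ _ hpi]
    ring
  exact not_tendsto_nhds_of_tendsto_atTop hinf _ hγ.norm
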